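/- Let h ≥ 1 be an integer, let w, w' ∈ 𝔽_h, and let u₋ ∈ 𝔄_h(w) and v₋ ∈ 𝔽_h with 0 ≤ v₋ ≤ 1 on Ω. Let (u_j, v_j)_{j≥1} be the alternating minimization sequences with boundary datum w' and initialization v₀ := v₋, i.e. u_j is the unique minimizer of J_h(·, v_{j−1}) over 𝔄_h(w') and v_j is the unique minimizer of J_h(u_j, ·) over {v ∈ 𝔽_h : v ≤ v_{j−1} on Ω}, and let (u⁺, v⁺) ∈ 𝔽_h × 𝔽_h be the limit of (u_j, v_j) as j → ∞. Then J_h(u⁺, v⁺) ≤ J_h(u₋, v₋) + ∫_Ω (P_h(v₋²) + η) ∇u₋ · ∇(w' − w) dx + ((1 + η)/2) ∫_Ω |∇(w' − w)|² dx. -/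

import Mathlib

open MeasureTheory Filter
open scoped Classical
open scoped RealInnerProductSpace

noncomputable section

abbrev E2 : Type := EuclideanSpace ℝ (Fin 2)

/-- The point `(a, b) ∈ ℝ²`. -/
def vtx (a b : ℝ) : E2 := (WithLp.equiv 2 (Fin 2 → ℝ)).symm ![a, b]

/-- The open unit square `Ω = (0,1)²`. -/
def Omega : Set E2 := {x | x 0 ∈ Set.Ioo (0:ℝ) 1 ∧ x 1 ∈ Set.Ioo (0:ℝ) 1}

/-- The closed unit square `Ω̄ = [0,1]²`. -/
def OmegaCl : Set E2 := {x | x 0 ∈ Set.Icc (0:ℝ) 1 ∧ x 1 ∈ Set.Icc (0:ℝ) 1}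

/-- The boundary `∂Ω = Ω̄ \ Ω`. -/
def OmegaBd : Set E2 := OmegaCl \ Omega

/-- Lower-left triangle `K⁺_{k,j}` of the uniform triangulation `𝒯_h`. -/
def Kplus (h k j : ℕ) : Set E2 :=
  {x | ((k:ℝ)-1)/h ≤ x 0 ∧ x 0 ≤ (k:ℝ)/h ∧ ((j:ℝ)-1)/h ≤ x 1 ∧
        x 1 ≤ ((j:ℝ)-1)/h + ((k:ℝ)/h - x 0)}

/-- Upper-right triangle `K⁻_{k,j}` of the uniform triangulation `𝒯_h`. -/
def Kminus (h k j : ℕ) : Set E2 :=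
  {x | ((k:ℝ)-1)/h ≤ x 0 ∧ x 0 ≤ (k:ℝ)/h ∧ (j:ℝ)/h + (((k:ℝ)-1)/h - x 0) ≤ x 1 ∧
        x 1 ≤ (j:ℝ)/h}

/-- `u` is affine on the set `S`. -/
def IsAffineOn (u : E2 → ℝ) (S : Set E2) : Prop :=
  ∃ (b : E2) (c : ℝ), ∀ x ∈ S, u x = ⟪b, x⟫ + c

/-- Membership in the finite element space `𝔽_h`: continuous on `Ω̄` and affine on every
triangle of the uniform triangulation `𝒯_h`. -/
def MemF (h : ℕ) (u : E2 → ℝ) : Prop :=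
  ContinuousOn u OmegaCl ∧
  ∀ k j : ℕ, 1 ≤ k → k ≤ h → 1 ≤ j → j ≤ h →
    IsAffineOn u (Kplus h k j) ∧ IsAffineOn u (Kminus h k j)

/-- The set `Δ_h` of vertices of the triangulation `𝒯_h`. -/
def Delta (h : ℕ) : Set E2 :=
  {x | ∃ k j : ℕ, k ≤ h ∧ j ≤ h ∧ x = vtx ((k:ℝ)/h) ((j:ℝ)/h)}

/-- The vertex `(k/h, j/h)` of `𝒯_h`. -/
def vertexPt (h k j : ℕ) : E2 := vtx ((k:ℝ)/h) ((j:ℝ)/h)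

/-- `p` is the Lagrange interpolant of `f` on `𝒯_h`: `p ∈ 𝔽_h` and `p = f` on `Δ_h`. -/
def Interpolates (h : ℕ) (f p : E2 → ℝ) : Prop :=
  MemF h p ∧ ∀ x ∈ Delta h, p x = f x

/-- The Lagrange interpolation operator `P_h` (a choice of interpolant; it is unique on `Ω̄`). -/

noncomputable def Ph (h : ℕ) (f : E2 → ℝ) : E2 → ℝ :=
  if hf : ∃ p, Interpolates h f p then hf.choose else 0

/-- Almost-everywhere defined gradient. -/
noncomputable def grad (u : E2 → ℝ) (x : E2) : E2 := gradient u x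

/-- The squared `H¹(Ω)` norm `‖u‖²_{H¹} = ∫_Ω (u² + |∇u|²)`. -/
noncomputable def H1normSq (u : E2 → ℝ) : ℝ :=
  ∫ x in Omega, ((u x)^2 + ‖grad u x‖^2)

/-- The discrete phase-field energy `J_h`. -/
noncomputable def Jh (h : ℕ) (η : ℝ) (u v : E2 → ℝ) : ℝ :=
  (1/2) * (∫ x in Omega, ((Ph h (fun y => (v y)^2) x + η) * ‖grad u x‖^2))
  + (1/2) * (∫ x in Omega, ‖grad v x‖^2)
  + (1/2) * (∫ x in Omega, Ph h (fun y => (1 - v y)^2) x)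

/-- `u ∈ 𝔄_h(w)`: `u ∈ 𝔽_h` and `u = w` on `∂Ω`. -/
def MemA (h : ℕ) (w u : E2 → ℝ) : Prop :=
  MemF h u ∧ ∀ x ∈ OmegaBd, u x = w x

/-- Convergence in `𝔽_h`, i.e. with respect to the `H¹(Ω)` norm. -/
def TendstoF (u : ℕ → E2 → ℝ) (ub : E2 → ℝ) : Prop :=
  Tendsto (fun j => H1normSq (fun y => u j y - ub y)) atTop (nhds 0)

/-- `u` minimizes `J_h(·, v)` over `𝔄_h(w)`. -/
def IsMinU (h : ℕ) (η : ℝ) (w v u : E2 → ℝ) : Prop :=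
  MemA h w u ∧ ∀ u', MemA h w u' → Jh h η u v ≤ Jh h η u' v

/-- `v` minimizes `J_h(u, ·)` over `{v ∈ 𝔽_h : v ≤ vprev on Ω}`. -/
def IsMinV (h : ℕ) (η : ℝ) (u vprev v : E2 → ℝ) : Prop :=
  (MemF h v ∧ ∀ x ∈ Omega, v x ≤ vprev x) ∧
  ∀ v', MemF h v' → (∀ x ∈ Omega, v' x ≤ vprev x) → Jh h η u v ≤ Jh h η u v'

end


/-- `K` is a closed triangle of the triangulation `𝒯_h`. -/
def IsTri (h : ℕ) (K : Set E2) : Prop :=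
  ∃ k j : ℕ, k < h ∧ j < h ∧ (K = Kplus h (k + 1) (j + 1) ∨ K = Kminus h (k + 1) (j + 1))

@[simp] lemma vtx_apply_zero (a b : ℝ) : vtx a b 0 = a := rfl

@[simp] lemma vtx_apply_one (a b : ℝ) : vtx a b 1 = b := rfl

lemma mem_Kplus_iff {h k j : ℕ} (hh : 1 ≤ h) {x : E2} :
    x ∈ Kplus h (k + 1) (j + 1) ↔ (k : ℝ) ≤ h * x 0 ∧ (j : ℝ) ≤ h * x 1 ∧
      h * x 0 + h * x 1 ≤ k + j + 1 := by
  have hp : (0 : ℝ) < h := by exact_mod_cast hh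
  have e : ((j : ℝ) / h + (((k : ℝ) + 1) / h - x 0)) = (j + (k + 1) - h * x 0) / h := by
    field_simp
    ring
  simp only [Kplus, Set.mem_ofPred_eq, Nat.cast_add, Nat.cast_one, add_sub_cancel_right]
  rw [e, div_le_iff₀ hp, le_div_iff₀ hp, div_le_iff₀ hp, le_div_iff₀ hp]
  constructor
  · rintro ⟨h1, h2, h3, h4⟩
    refine ⟨?_, ?_, ?_⟩ <;> linarith
  · rintro ⟨h1, h2, h3⟩
    refine ⟨?_, ?_, ?_, ?_⟩ <;> linarith

lemma mem_Kminus_iff {h k j : ℕ} (hh : 1 ≤ h) {x : E2} :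
    x ∈ Kminus h (k + 1) (j + 1) ↔ h * x 0 ≤ k + 1 ∧ h * x 1 ≤ j + 1 ∧
      (k : ℝ) + j + 1 ≤ h * x 0 + h * x 1 := by
  have hp : (0 : ℝ) < h := by exact_mod_cast hh
  have e : (((j : ℝ) + 1) / h + ((k : ℝ) / h - x 0)) = (j + 1 + k - h * x 0) / h := by
    field_simp
    ring
  simp only [Kminus, Set.mem_ofPred_eq, Nat.cast_add, Nat.cast_one, add_sub_cancel_right]
  rw [e, div_le_iff₀ hp, le_div_iff₀ hp, div_le_iff₀ hp, le_div_iff₀ hp]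
  constructor
  · rintro ⟨h1, h2, h3, h4⟩
    refine ⟨?_, ?_, ?_⟩ <;> linarith
  · rintro ⟨h1, h2, h3⟩
    refine ⟨?_, ?_, ?_, ?_⟩ <;> linarith

lemma IsTri.convex {h : ℕ} (hh : 1 ≤ h) {K : Set E2} (hK : IsTri h K) : Convex ℝ K := by
  obtain ⟨k, j, -, -, rfl | rfl⟩ := hK <;> intro x hx y hy a b ha hb hab
  · rw [mem_Kplus_iff hh] at *
    obtain rfl : b = 1 - a := by linarith
    simp only [PiLp.add_apply, PiLp.smul_apply, smul_eq_mul]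
    refine ⟨?_, ?_, ?_⟩ <;> nlinarith
  · rw [mem_Kminus_iff hh] at *
    obtain rfl : b = 1 - a := by linarith
    simp only [PiLp.add_apply, PiLp.smul_apply, smul_eq_mul]
    refine ⟨?_, ?_, ?_⟩ <;> nlinarith

lemma IsTri.subset {h : ℕ} (hh : 1 ≤ h) {K : Set E2} (hK : IsTri h K) : K ⊆ OmegaCl := by
  have hp : (0 : ℝ) < h := by exact_mod_cast hh
  obtain ⟨k, j, hk, hj, hK⟩ := hK
  have hk' : (k : ℝ) + 1 ≤ h := by exact_mod_cast hk
  have hj' : (j : ℝ) + 1 ≤ h := by exact_mod_cast hj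
  have hk0 : (0 : ℝ) ≤ k := k.cast_nonneg
  have hj0 : (0 : ℝ) ≤ j := j.cast_nonneg
  intro x hx
  have key : 0 ≤ h * x 0 ∧ h * x 0 ≤ h ∧ 0 ≤ h * x 1 ∧ h * x 1 ≤ h := by
    rcases hK with rfl | rfl
    · rw [mem_Kplus_iff hh] at hx
      obtain ⟨h1, h2, h3⟩ := hx
      refine ⟨?_, ?_, ?_, ?_⟩ <;> linarith
    · rw [mem_Kminus_iff hh] at hx
      obtain ⟨h1, h2, h3⟩ := hx
      refine ⟨?_, ?_, ?_, ?_⟩ <;> linarith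
  obtain ⟨h1, h2, h3, h4⟩ := key
  exact ⟨⟨by nlinarith, by nlinarith⟩, ⟨by nlinarith, by nlinarith⟩⟩

lemma isOpen_Omega : IsOpen Omega := by
  have h0 : Continuous fun x : E2 => x 0 := by fun_prop
  have h1 : Continuous fun x : E2 => x 1 := by fun_prop
  exact (isOpen_Ioo.preimage h0).inter (isOpen_Ioo.preimage h1)

lemma Omega_subset : Omega ⊆ OmegaCl :=
  fun _ hx => ⟨⟨hx.1.1.le, hx.1.2.le⟩, ⟨hx.2.1.le, hx.2.2.le⟩⟩

lemma IsTri.interior_inter_nonempty {h : ℕ} (hh : 1 ≤ h) {K : Set E2} (hK : IsTri h K) :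
    (interior K ∩ Omega).Nonempty := by
  have hp : (0 : ℝ) < h := by exact_mod_cast hh
  have c0 : Continuous fun x : E2 => (h : ℝ) * x 0 := by fun_prop
  have c1 : Continuous fun x : E2 => (h : ℝ) * x 1 := by fun_prop
  have c2 : Continuous fun x : E2 => (h : ℝ) * x 0 + h * x 1 := by fun_prop
  obtain ⟨k, j, hk, hj, hK⟩ := hK
  have hk' : (k : ℝ) + 1 ≤ h := by exact_mod_cast hk
  have hj' : (j : ℝ) + 1 ≤ h := by exact_mod_cast hj
  have hk0 : (0 : ℝ) ≤ k := k.cast_nonneg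
  have hj0 : (0 : ℝ) ≤ j := j.cast_nonneg
  have mem (a b : ℝ) (ha : 0 < a ∧ a < h) (hb : 0 < b ∧ b < h) : vtx (a / h) (b / h) ∈ Omega :=
    ⟨⟨div_pos ha.1 hp, (div_lt_one hp).2 ha.2⟩, ⟨div_pos hb.1 hp, (div_lt_one hp).2 hb.2⟩⟩
  have canc (a : ℝ) : (h : ℝ) * (a / h) = a := by field_simp
  rcases hK with rfl | rfl
  · refine ⟨vtx ((k + 1 / 3) / h) ((j + 1 / 3) / h), ?_, mem _ _ ⟨?_, ?_⟩ ⟨?_, ?_⟩⟩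
    · refine interior_maximal (s := Kplus h (k + 1) (j + 1))
        (t := {x : E2 | (k : ℝ) < h * x 0} ∩ ({x | (j : ℝ) < h * x 1} ∩
          {x | h * x 0 + h * x 1 < (k : ℝ) + j + 1})) ?_ ?_ ?_
      · rintro x ⟨h1, h2, h3⟩
        exact (mem_Kplus_iff hh).2 ⟨le_of_lt h1, le_of_lt h2, le_of_lt h3⟩
      · exact (isOpen_lt continuous_const c0).inter
          ((isOpen_lt continuous_const c1).inter (isOpen_lt c2 continuous_const))
      · refine ⟨?_, ?_, ?_⟩ <;>
          simp only [Set.mem_ofPred_eq, vtx_apply_zero, vtx_apply_one, canc] <;> linarith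
    all_goals linarith
  · refine ⟨vtx ((k + 2 / 3) / h) ((j + 2 / 3) / h), ?_, mem _ _ ⟨?_, ?_⟩ ⟨?_, ?_⟩⟩
    · refine interior_maximal (s := Kminus h (k + 1) (j + 1))
        (t := {x : E2 | h * x 0 < (k : ℝ) + 1} ∩ ({x | h * x 1 < (j : ℝ) + 1} ∩
          {x | (k : ℝ) + j + 1 < h * x 0 + h * x 1})) ?_ ?_ ?_
      · rintro x ⟨h1, h2, h3⟩
        exact (mem_Kminus_iff hh).2 ⟨le_of_lt h1, le_of_lt h2, le_of_lt h3⟩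
      · exact (isOpen_lt c0 continuous_const).inter
          ((isOpen_lt c1 continuous_const).inter (isOpen_lt continuous_const c2))
      · refine ⟨?_, ?_, ?_⟩ <;>
          simp only [Set.mem_ofPred_eq, vtx_apply_zero, vtx_apply_one, canc] <;> linarith
    all_goals linarith

lemma finite_isTri (h : ℕ) : {K | IsTri h K}.Finite := by
  have : {K | IsTri h K} ⊆
      (fun p : ℕ × ℕ => Kplus h (p.1 + 1) (p.2 + 1)) '' (Set.Iio h ×ˢ Set.Iio h) ∪
      (fun p : ℕ × ℕ => Kminus h (p.1 + 1) (p.2 + 1)) '' (Set.Iio h ×ˢ Set.Iio h) := by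
    rintro K ⟨k, j, hk, hj, rfl | rfl⟩
    · exact Or.inl ⟨(k, j), ⟨hk, hj⟩, rfl⟩
    · exact Or.inr ⟨(k, j), ⟨hk, hj⟩, rfl⟩
  have hf := (Set.finite_Iio h).prod (Set.finite_Iio h)
  exact ((hf.image _).union (hf.image _)).subset this

lemma exists_isTri_mem {h : ℕ} (hh : 1 ≤ h) {x : E2} (hx : x ∈ Omega) :
    ∃ K, IsTri h K ∧ x ∈ K := by
  have hp : (0 : ℝ) < h := by exact_mod_cast hh
  have key (t : ℝ) (ht : t ∈ Set.Ioo (0 : ℝ) 1) :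
      ∃ k : ℕ, k < h ∧ (k : ℝ) ≤ h * t ∧ h * t ≤ k + 1 := by
    have h0 : 0 ≤ h * t := mul_nonneg hp.le ht.1.le
    refine ⟨⌊h * t⌋₊, ?_, Nat.floor_le h0, (Nat.lt_floor_add_one _).le⟩
    rw [Nat.floor_lt h0]
    nlinarith [ht.2]
  obtain ⟨k, hk, hk1, hk2⟩ := key _ hx.1
  obtain ⟨j, hj, hj1, hj2⟩ := key _ hx.2
  rcases le_total (h * x 0 + h * x 1) ((k : ℝ) + j + 1) with hs | hs
  · exact ⟨_, ⟨k, j, hk, hj, Or.inl rfl⟩, (mem_Kplus_iff hh).2 ⟨hk1, hj1, hs⟩⟩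
  · exact ⟨_, ⟨k, j, hk, hj, Or.inr rfl⟩, (mem_Kminus_iff hh).2 ⟨hk2, hj2, hs⟩⟩

lemma exists_barycentric {h : ℕ} (hh : 1 ≤ h) {K : Set E2} (hK : IsTri h K) {x : E2}
    (hx : x ∈ K) : ∃ (l : Fin 3 → ℝ) (a : Fin 3 → E2), (∀ i, 0 ≤ l i) ∧ ∑ i, l i = 1 ∧
      (∀ i, a i ∈ K) ∧ (∀ i, a i ∈ Delta h) ∧ x = ∑ i, l i • a i := by
  have hp : (0 : ℝ) < h := by exact_mod_cast hh
  have canc (a : ℝ) : (h : ℝ) * (a / h) = a := by field_simp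
  obtain ⟨k, j, hk, hj, hK⟩ := hK
  have hD (m n : ℕ) (hm : m ≤ h) (hn : n ≤ h) : vtx ((m : ℝ) / h) ((n : ℝ) / h) ∈ Delta h :=
    ⟨m, n, hm, hn, rfl⟩
  rcases hK with rfl | rfl
  · rw [mem_Kplus_iff hh] at hx
    obtain ⟨h1, h2, h3⟩ := hx
    refine ⟨![1 - (h * x 0 - k) - (h * x 1 - j), h * x 0 - k, h * x 1 - j],
      ![vtx ((k : ℕ) / h) ((j : ℕ) / h), vtx ((k + 1 : ℕ) / h) ((j : ℕ) / h),
        vtx ((k : ℕ) / h) ((j + 1 : ℕ) / h)], ?_, ?_, ?_, ?_, ?_⟩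
    · intro i; fin_cases i <;> simp <;> linarith
    · simp [Fin.sum_univ_three]
      ring
    · intro i
      rw [mem_Kplus_iff hh]
      fin_cases i <;> simp [canc] <;> linarith
    · intro i; fin_cases i
      · exact hD k j hk.le hj.le
      · exact hD (k + 1) j hk hj.le
      · exact hD k (j + 1) hk.le hj
    · ext i; fin_cases i <;> simp [Fin.sum_univ_three] <;> field_simp <;> ring
  · rw [mem_Kminus_iff hh] at hx
    obtain ⟨h1, h2, h3⟩ := hx
    refine ⟨![1 - (k + 1 - h * x 0) - (j + 1 - h * x 1), k + 1 - h * x 0, j + 1 - h * x 1],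
      ![vtx ((k + 1 : ℕ) / h) ((j + 1 : ℕ) / h), vtx ((k : ℕ) / h) ((j + 1 : ℕ) / h),
        vtx ((k + 1 : ℕ) / h) ((j : ℕ) / h)], ?_, ?_, ?_, ?_, ?_⟩
    · intro i; fin_cases i <;> simp <;> linarith
    · simp [Fin.sum_univ_three]
      ring
    · intro i
      rw [mem_Kminus_iff hh]
      fin_cases i <;> simp [canc] <;> linarith
    · intro i; fin_cases i
      · exact hD (k + 1) (j + 1) hk hj
      · exact hD k (j + 1) hk.le hj
      · exact hD (k + 1) j hk hj.le
    · ext i; fin_cases i <;> simp [Fin.sum_univ_three] <;> field_simp <;> ring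

lemma MemF.isAffineOn {h : ℕ} {u : E2 → ℝ} (hu : MemF h u) {K : Set E2} (hK : IsTri h K) :
    IsAffineOn u K := by
  obtain ⟨k, j, hk, hj, rfl | rfl⟩ := hK
  · exact (hu.2 (k + 1) (j + 1) (by lia) hk (by lia) hj).1
  · exact (hu.2 (k + 1) (j + 1) (by lia) hk (by lia) hj).2

lemma memF_of_isAffineOn {h : ℕ} {u : E2 → ℝ} (hc : ContinuousOn u OmegaCl)
    (hu : ∀ K, IsTri h K → IsAffineOn u K) : MemF h u := by
  refine ⟨hc, fun k j hk hkh hj hjh => ?_⟩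
  obtain ⟨k, rfl⟩ := Nat.exists_eq_add_of_le' hk
  obtain ⟨j, rfl⟩ := Nat.exists_eq_add_of_le' hj
  exact ⟨hu _ ⟨k, j, hkh, hjh, Or.inl rfl⟩, hu _ ⟨k, j, hkh, hjh, Or.inr rfl⟩⟩

lemma MemF.add {h : ℕ} {u v : E2 → ℝ} (hu : MemF h u) (hv : MemF h v) :
    MemF h (fun x => u x + v x) := by
  refine memF_of_isAffineOn (hu.1.add hv.1) fun K hK => ?_
  obtain ⟨b, c, hb⟩ := hu.isAffineOn hK
  obtain ⟨b', c', hb'⟩ := hv.isAffineOn hK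
  refine ⟨b + b', c + c', fun x hx => ?_⟩
  simp only [hb x hx, hb' x hx, inner_add_left]
  ring

lemma MemF.const_mul {h : ℕ} {u : E2 → ℝ} (hu : MemF h u) (r : ℝ) :
    MemF h (fun x => r * u x) := by
  refine memF_of_isAffineOn (continuousOn_const.mul hu.1) fun K hK => ?_
  obtain ⟨b, c, hb⟩ := hu.isAffineOn hK
  refine ⟨r • b, r * c, fun x hx => ?_⟩
  simp only [hb x hx, real_inner_smul_left]
  ring

lemma MemF.sub {h : ℕ} {u v : E2 → ℝ} (hu : MemF h u) (hv : MemF h v) :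
    MemF h (fun x => u x - v x) := by
  simpa [sub_eq_add_neg] using hu.add (hv.const_mul (-1))

lemma memF_zero (h : ℕ) : MemF h fun _ => 0 :=
  memF_of_isAffineOn continuousOn_const fun _ _ => ⟨0, 0, by simp⟩

lemma memF_sum {h : ℕ} {ι : Type*} (s : Finset ι) {f : ι → E2 → ℝ} (hf : ∀ i, MemF h (f i)) :
    MemF h (fun x => ∑ i ∈ s, f i x) := by
  induction s using Finset.induction_on with
  | empty => simpa using memF_zero h
  | insert i s hi ih => simpa [Finset.sum_insert hi] using (hf i).add ih

/-- The hat function of the unit lattice triangulated along the direction `(1, -1)`. -/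
def hat (s t : ℝ) : ℝ := max 0 (1 - max |s| (max |t| |s + t|))

lemma hat_affine_lower (a b : ℤ) : ∃ p q r : ℝ, ∀ s t : ℝ, a ≤ s → b ≤ t → s + t ≤ a + b + 1 →
    hat s t = p * s + q * t + r := by
  by_cases h1 : 1 ≤ a ∨ a ≤ -2 ∨ 1 ≤ b ∨ b ≤ -2
  · refine ⟨0, 0, 0, fun s t hs ht hst => ?_⟩
    have h1' : (1 : ℝ) ≤ a ∨ (a : ℝ) ≤ -2 ∨ (1 : ℝ) ≤ b ∨ (b : ℝ) ≤ -2 := by exact_mod_cast h1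
    unfold hat
    grind
  · obtain ⟨ha, hb⟩ : (a = 0 ∨ a = -1) ∧ (b = 0 ∨ b = -1) := by lia
    rcases ha with rfl | rfl <;> rcases hb with rfl | rfl
    · refine ⟨-1, -1, 1, fun s t hs ht hst => ?_⟩
      unfold hat
      grind
    · refine ⟨0, 1, 1, fun s t hs ht hst => ?_⟩
      unfold hat
      grind
    · refine ⟨1, 0, 1, fun s t hs ht hst => ?_⟩
      unfold hat
      grind
    · refine ⟨0, 0, 0, fun s t hs ht hst => ?_⟩
      unfold hat
      grind

lemma hat_affine_upper (a b : ℤ) : ∃ p q r : ℝ, ∀ s t : ℝ, s ≤ a + 1 → t ≤ b + 1 →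
    a + b + 1 ≤ s + t → hat s t = p * s + q * t + r := by
  obtain ⟨p, q, r, H⟩ := hat_affine_lower (-a - 1) (-b - 1)
  refine ⟨-p, -q, r, fun s t hs ht hst => ?_⟩
  have := H (-s) (-t) (by push_cast; linarith) (by push_cast; linarith) (by push_cast; linarith)
  have e : hat (-s) (-t) = hat s t := by
    simp only [hat, abs_neg, ← neg_add]
  rw [← e, this]
  ring

lemma hat_int (m n : ℤ) : hat m n = if m = 0 ∧ n = 0 then 1 else 0 := by
  split_ifs with h0
  · simp [hat, h0.1, h0.2]
  · have h1 : (1 : ℝ) ≤ m ∨ (m : ℝ) ≤ -1 ∨ (1 : ℝ) ≤ n ∨ (n : ℝ) ≤ -1 := by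
      have : 1 ≤ m ∨ m ≤ -1 ∨ 1 ≤ n ∨ n ≤ -1 := by lia
      exact_mod_cast this
    unfold hat
    grind

lemma memF_hat {h : ℕ} (hh : 1 ≤ h) (k₀ j₀ : ℕ) :
    MemF h fun x => hat (h * x 0 - k₀) (h * x 1 - j₀) := by
  refine memF_of_isAffineOn (Continuous.continuousOn (by unfold hat; fun_prop)) fun K hK => ?_
  obtain ⟨k, j, -, -, hK⟩ := hK
  have aux (p q r : ℝ) (x : E2) : p * (h * x 0 - k₀) + q * (h * x 1 - j₀) + r =
      ⟪vtx (p * h) (q * h), x⟫ + (r - p * k₀ - q * j₀) := by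
    simp [PiLp.inner_apply]
    ring
  rcases hK with rfl | rfl
  · obtain ⟨p, q, r, H⟩ := hat_affine_lower (k - k₀ : ℤ) (j - j₀ : ℤ)
    refine ⟨vtx (p * h) (q * h), r - p * k₀ - q * j₀, fun x hx => ?_⟩
    rw [mem_Kplus_iff hh] at hx
    rw [← aux]
    apply H <;> push_cast <;> linarith
  · obtain ⟨p, q, r, H⟩ := hat_affine_upper (k - k₀ : ℤ) (j - j₀ : ℤ)
    refine ⟨vtx (p * h) (q * h), r - p * k₀ - q * j₀, fun x hx => ?_⟩
    rw [mem_Kminus_iff hh] at hx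
    rw [← aux]
    apply H <;> push_cast <;> linarith

lemma exists_interpolates {h : ℕ} (hh : 1 ≤ h) (f : E2 → ℝ) : ∃ p, Interpolates h f p := by
  have hp : (0 : ℝ) < h := by exact_mod_cast hh
  have canc (a : ℝ) : (h : ℝ) * (a / h) = a := by field_simp
  refine ⟨fun x => ∑ p ∈ Finset.range (h + 1) ×ˢ Finset.range (h + 1),
    f (vertexPt h p.1 p.2) * hat (h * x 0 - p.1) (h * x 1 - p.2),
    memF_sum _ fun p => (memF_hat hh p.1 p.2).const_mul _, ?_⟩
  rintro _ ⟨k, j, hk, hj, rfl⟩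
  have H (p : ℕ × ℕ) : hat ((k : ℝ) - p.1) ((j : ℝ) - p.2) = if p = (k, j) then 1 else 0 := by
    have := hat_int (k - p.1) (j - p.2)
    push_cast at this
    rw [this]
    refine if_congr ?_ rfl rfl
    rw [Prod.ext_iff]
    simp only
    lia
  simp only [vtx_apply_zero, vtx_apply_one, canc, H]
  simp [vertexPt, hk, hj]

lemma Ph_interpolates {h : ℕ} (hh : 1 ≤ h) (f : E2 → ℝ) : Interpolates h f (Ph h f) := by
  rw [Ph, dif_pos (exists_interpolates hh f)]
  exact (exists_interpolates hh f).choose_spec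

lemma norm_sq_eq (x : E2) : ‖x‖ ^ 2 = x 0 ^ 2 + x 1 ^ 2 := by
  simp [EuclideanSpace.norm_sq_eq]

lemma norm_sq_le_two {x : E2} (hx : x ∈ OmegaCl) : ‖x‖ ^ 2 ≤ 2 := by
  obtain ⟨⟨h1, h2⟩, h3, h4⟩ := hx
  rw [norm_sq_eq]
  nlinarith

lemma isCompact_OmegaCl : IsCompact OmegaCl := by
  have h0 : Continuous fun x : E2 => x 0 := by fun_prop
  have h1 : Continuous fun x : E2 => x 1 := by fun_prop
  refine Metric.isCompact_of_isClosed_isBounded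
    ((isClosed_Icc.preimage h0).inter (isClosed_Icc.preimage h1)) ?_
  refine (Metric.isBounded_closedBall (x := (0 : E2)) (r := 2)).subset fun x hx => ?_
  have := norm_sq_le_two hx
  rw [mem_closedBall_zero_iff]
  nlinarith [norm_nonneg x]

instance : IsFiniteMeasure (volume.restrict Omega) := by
  refine ⟨?_⟩
  rw [Measure.restrict_apply_univ]
  exact (measure_mono Omega_subset).trans_lt isCompact_OmegaCl.measure_lt_top

lemma OmegaCl_subset_closure : OmegaCl ⊆ closure Omega := by
  intro x hx
  have hc : Continuous fun t : ℝ => x + t • (vtx (1 / 2) (1 / 2) - x) := by fun_prop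
  have hlim : Tendsto (fun t : ℝ => x + t • (vtx (1 / 2) (1 / 2) - x)) (nhdsWithin 0 (Set.Ioi 0))
      (nhds x) := by
    have := hc.tendsto 0
    simp only [zero_smul, add_zero] at this
    exact this.mono_left nhdsWithin_le_nhds
  refine mem_closure_of_tendsto hlim ?_
  filter_upwards [Ioo_mem_nhdsGT (zero_lt_one' ℝ)] with t ht
  obtain ⟨⟨h1, h2⟩, h3, h4⟩ := hx
  obtain ⟨ht0, ht1⟩ := ht
  refine ⟨⟨?_, ?_⟩, ?_, ?_⟩ <;>
    simp only [PiLp.add_apply, PiLp.smul_apply, PiLp.sub_apply, smul_eq_mul, vtx_apply_zero,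
      vtx_apply_one] <;> nlinarith

lemma closure_Omega : closure Omega = OmegaCl :=
  (closure_minimal Omega_subset isCompact_OmegaCl.isClosed).antisymm OmegaCl_subset_closure

lemma le_on_OmegaCl {f : E2 → ℝ} (hf : ContinuousOn f OmegaCl) {M : ℝ}
    (h : ∀ x ∈ Omega, f x ≤ M) : ∀ x ∈ OmegaCl, f x ≤ M := by
  rw [← closure_Omega] at *
  exact le_on_closure h hf continuousOn_const

lemma Delta_subset {h : ℕ} (hh : 1 ≤ h) : Delta h ⊆ OmegaCl := by
  have hp : (0 : ℝ) < h := by exact_mod_cast hh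
  rintro _ ⟨k, j, hk, hj, rfl⟩
  have hk' : (k : ℝ) ≤ h := by exact_mod_cast hk
  have hj' : (j : ℝ) ≤ h := by exact_mod_cast hj
  exact ⟨⟨by simp; positivity, by simpa [div_le_one hp]⟩,
    ⟨by simp; positivity, by simpa [div_le_one hp]⟩⟩

/-- The value of a finite element function is a fixed convex combination of vertex values. -/
lemma exists_weights {h : ℕ} (hh : 1 ≤ h) {x : E2} (hx : x ∈ Omega) :
    ∃ (l : Fin 3 → ℝ) (a : Fin 3 → E2), (∀ i, 0 ≤ l i) ∧ ∑ i, l i = 1 ∧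
      (∀ i, a i ∈ Delta h) ∧ ∀ p, MemF h p → p x = ∑ i, l i * p (a i) := by
  obtain ⟨K, hK, hxK⟩ := exists_isTri_mem hh hx
  obtain ⟨l, a, hl, hl1, haK, haD, hxa⟩ := exists_barycentric hh hK hxK
  refine ⟨l, a, hl, hl1, haD, fun p hp => ?_⟩
  obtain ⟨b, c, hb⟩ := hp.isAffineOn hK
  rw [hb x hxK]
  simp only [fun i => hb (a i) (haK i), mul_add, Finset.sum_add_distrib, ← Finset.sum_mul, hl1,
    one_mul]
  rw [hxa, inner_sum]
  simp [real_inner_smul_right]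

lemma Ph_memF {h : ℕ} (hh : 1 ≤ h) (f : E2 → ℝ) : MemF h (Ph h f) := (Ph_interpolates hh f).1

lemma exists_weights_Ph {h : ℕ} (hh : 1 ≤ h) {x : E2} (hx : x ∈ Omega) :
    ∃ (l : Fin 3 → ℝ) (a : Fin 3 → E2), (∀ i, 0 ≤ l i) ∧ ∑ i, l i = 1 ∧
      (∀ i, a i ∈ Delta h) ∧ ∀ f, Ph h f x = ∑ i, l i * f (a i) := by
  obtain ⟨l, a, hl, hl1, haD, H⟩ := exists_weights hh hx
  refine ⟨l, a, hl, hl1, haD, fun f => ?_⟩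
  rw [H _ (Ph_memF hh f)]
  exact Finset.sum_congr rfl fun i _ => by rw [(Ph_interpolates hh f).2 _ (haD i)]

lemma Ph_le {h : ℕ} (hh : 1 ≤ h) {f : E2 → ℝ} {M : ℝ} (hf : ∀ x ∈ OmegaCl, f x ≤ M) {x : E2}
    (hx : x ∈ Omega) : Ph h f x ≤ M := by
  obtain ⟨l, a, hl, hl1, haD, H⟩ := exists_weights_Ph hh hx
  calc Ph h f x = ∑ i, l i * f (a i) := H f
    _ ≤ ∑ i, l i * M := Finset.sum_le_sum fun i _ =>
        mul_le_mul_of_nonneg_left (hf _ (Delta_subset hh (haD i))) (hl i)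
    _ = M := by rw [← Finset.sum_mul, hl1, one_mul]

lemma le_Ph {h : ℕ} (hh : 1 ≤ h) {f : E2 → ℝ} {M : ℝ} (hf : ∀ x ∈ OmegaCl, M ≤ f x) {x : E2}
    (hx : x ∈ Omega) : M ≤ Ph h f x := by
  obtain ⟨l, a, hl, hl1, haD, H⟩ := exists_weights_Ph hh hx
  calc M = ∑ i, l i * M := by rw [← Finset.sum_mul, hl1, one_mul]
    _ ≤ ∑ i, l i * f (a i) := Finset.sum_le_sum fun i _ =>
        mul_le_mul_of_nonneg_left (hf _ (Delta_subset hh (haD i))) (hl i)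
    _ = Ph h f x := (H f).symm

lemma tendsto_Ph {h : ℕ} (hh : 1 ≤ h) {f : ℕ → E2 → ℝ} {g : E2 → ℝ}
    (hf : ∀ x ∈ OmegaCl, Tendsto (fun n => f n x) atTop (nhds (g x))) {x : E2} (hx : x ∈ Omega) :
    Tendsto (fun n => Ph h (f n) x) atTop (nhds (Ph h g x)) := by
  obtain ⟨l, a, hl, hl1, haD, H⟩ := exists_weights_Ph hh hx
  simp only [H]
  exact tendsto_finsetSum _ fun i _ => (hf _ (Delta_subset hh (haD i))).const_mul _

lemma ae_exists_mem_interior {h : ℕ} (hh : 1 ≤ h) :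
    ∀ᵐ x ∂volume.restrict Omega, ∃ K, IsTri h K ∧ x ∈ interior K := by
  have h1 : ∀ᵐ x ∂volume.restrict Omega, ∀ K ∈ {K | IsTri h K}, x ∉ frontier K := by
    rw [ae_ball_iff (finite_isTri h).countable]
    intro K hK
    exact ae_restrict_of_ae (measure_eq_zero_iff_ae_notMem.1 ((hK.convex hh).addHaar_frontier _))
  filter_upwards [h1, ae_restrict_mem isOpen_Omega.measurableSet] with x hx hxO
  obtain ⟨K, hK, hxK⟩ := exists_isTri_mem hh hxO
  refine ⟨K, hK, ?_⟩
  by_contra hi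
  exact hx K hK ⟨subset_closure hxK, hi⟩

lemma hasGradientAt_of_mem_interior {u : E2 → ℝ} {K : Set E2} {b : E2} {c : ℝ}
    (hb : ∀ x ∈ K, u x = ⟪b, x⟫ + c) {x : E2} (hx : x ∈ interior K) : HasGradientAt u b x := by
  rw [hasGradientAt_iff_hasFDerivAt]
  have h1 : HasFDerivAt (fun y : E2 => ⟪b, y⟫ + c) (InnerProductSpace.toDual ℝ E2 b) x :=
    ((InnerProductSpace.toDual ℝ E2 b).hasFDerivAt).add_const c
  refine h1.congr_of_eventuallyEq ?_
  filter_upwards [mem_interior_iff_mem_nhds.1 hx] with y hy using hb y hy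

lemma MemF.ae_differentiableAt {h : ℕ} (hh : 1 ≤ h) {u : E2 → ℝ} (hu : MemF h u) :
    ∀ᵐ x ∂volume.restrict Omega, DifferentiableAt ℝ u x := by
  filter_upwards [ae_exists_mem_interior hh] with x ⟨K, hK, hx⟩
  obtain ⟨b, c, hb⟩ := hu.isAffineOn hK
  exact (hasGradientAt_of_mem_interior hb hx).differentiableAt

lemma grad_add {u v : E2 → ℝ} {x : E2} (hu : DifferentiableAt ℝ u x)
    (hv : DifferentiableAt ℝ v x) : grad (fun y => u y + v y) x = grad u x + grad v x := by
  simp only [grad, gradient]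
  rw [fderiv_fun_add hu hv, map_add]

lemma grad_sub {u v : E2 → ℝ} {x : E2} (hu : DifferentiableAt ℝ u x)
    (hv : DifferentiableAt ℝ v x) : grad (fun y => u y - v y) x = grad u x - grad v x := by
  simp only [grad, gradient]
  rw [fderiv_fun_sub hu hv, map_sub]

lemma measurable_grad (u : E2 → ℝ) : Measurable (grad u) :=
  (InnerProductSpace.toDual ℝ E2).symm.continuous.measurable.comp (measurable_fderiv ℝ u)

lemma MemF.exists_norm_grad_le {h : ℕ} (hh : 1 ≤ h) {u : E2 → ℝ} (hu : MemF h u) :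
    ∃ M, ∀ᵐ x ∂volume.restrict Omega, ‖grad u x‖ ≤ M := by
  have H : ∀ᶠ M : ℝ in atTop, ∀ K ∈ {K | IsTri h K}, ∀ x ∈ interior K, ‖grad u x‖ ≤ M := by
    rw [eventually_all_finite (finite_isTri h)]
    intro K hK
    obtain ⟨b, c, hb⟩ := hu.isAffineOn hK
    filter_upwards [eventually_ge_atTop ‖b‖] with M hM x hx
    rwa [grad, (hasGradientAt_of_mem_interior hb hx).gradient]
  obtain ⟨M, hM⟩ := H.exists
  refine ⟨M, ?_⟩
  filter_upwards [ae_exists_mem_interior hh] with x ⟨K, hK, hx⟩ using hM K hK x hx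

lemma MemF.aestronglyMeasurable {h : ℕ} {u : E2 → ℝ} (hu : MemF h u) :
    AEStronglyMeasurable u (volume.restrict Omega) :=
  (hu.1.mono Omega_subset).aestronglyMeasurable isOpen_Omega.measurableSet

lemma MemF.exists_abs_le {h : ℕ} {u : E2 → ℝ} (hu : MemF h u) :
    ∃ M, ∀ x ∈ OmegaCl, |u x| ≤ M :=
  isCompact_OmegaCl.exists_bound_of_continuousOn hu.1

lemma MemF.memLp_top {h : ℕ} {u : E2 → ℝ} (hu : MemF h u) :
    MemLp u ⊤ (volume.restrict Omega) := by
  obtain ⟨M, hM⟩ := hu.exists_abs_le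
  refine memLp_top_of_bound hu.aestronglyMeasurable M ?_
  filter_upwards [ae_restrict_mem isOpen_Omega.measurableSet] with x hx
    using hM x (Omega_subset hx)

lemma MemF.integrable_inner_grad {h : ℕ} (hh : 1 ≤ h) {u v : E2 → ℝ} (hu : MemF h u)
    (hv : MemF h v) : Integrable (fun x => ⟪grad u x, grad v x⟫) (volume.restrict Omega) := by
  obtain ⟨M, hM⟩ := hu.exists_norm_grad_le hh
  obtain ⟨N, hN⟩ := hv.exists_norm_grad_le hh
  refine Integrable.of_bound ((measurable_grad u).aestronglyMeasurable.inner
    (measurable_grad v).aestronglyMeasurable) (M * N) ?_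
  filter_upwards [hM, hN] with x h1 h2
  exact (norm_inner_le_norm _ _).trans
    (mul_le_mul h1 h2 (norm_nonneg _) ((norm_nonneg _).trans h1))

lemma MemF.integrable_norm_grad_sq {h : ℕ} (hh : 1 ≤ h) {u : E2 → ℝ} (hu : MemF h u) :
    Integrable (fun x => ‖grad u x‖ ^ 2) (volume.restrict Omega) := by
  simpa only [real_inner_self_eq_norm_sq] using hu.integrable_inner_grad hh hu

lemma MemF.integrable_weight_mul {h : ℕ} {P f : E2 → ℝ} (hP : MemF h P) (η : ℝ)
    (hf : Integrable f (volume.restrict Omega)) :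
    Integrable (fun x => (P x + η) * f x) (volume.restrict Omega) :=
  hf.mul_of_top_right (hP.memLp_top.add (memLp_const η))

lemma MemF.integrable_H1 {h : ℕ} (hh : 1 ≤ h) {u : E2 → ℝ} (hu : MemF h u) :
    Integrable (fun x => u x ^ 2 + ‖grad u x‖ ^ 2) (volume.restrict Omega) :=
  ((hu.memLp_top.mono_exponent le_top).integrable_sq).add (hu.integrable_norm_grad_sq hh)

/-- Inverse inequality: the `H¹` norm on `𝔽_h` controls the `W^{1,∞}` norm. -/
lemma exists_inverse_inequality {h : ℕ} (hh : 1 ≤ h) :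
    ∃ C : ℝ, ∀ z, MemF h z → (∀ x ∈ OmegaCl, z x ^ 2 ≤ C * H1normSq z) ∧
      ∀ᵐ x ∂volume.restrict Omega, ‖grad z x‖ ^ 2 ≤ C * H1normSq z := by
  have H : ∀ᶠ C : ℝ in atTop, ∀ K ∈ {K | IsTri h K}, ∀ z, MemF h z →
      (∀ x ∈ K, z x ^ 2 ≤ C * H1normSq z) ∧
      ∀ x ∈ interior K, ‖grad z x‖ ^ 2 ≤ C * H1normSq z := by
    rw [eventually_all_finite (finite_isTri h)]
    intro K hK
    set S := interior K ∩ Omega with hS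
    have hSo : IsOpen S := isOpen_interior.inter isOpen_Omega
    have hfin : volume S ≠ ⊤ :=
      ((measure_mono (Set.inter_subset_right.trans Omega_subset)).trans_lt
        isCompact_OmegaCl.measure_lt_top).ne
    have hm : 0 < volume.real S :=
      ENNReal.toReal_pos (hSo.measure_pos volume (hK.interior_inter_nonempty hh)).ne' hfin
    filter_upwards [eventually_ge_atTop (20 / volume.real S)] with C hC z hz
    obtain ⟨b, c, hb⟩ := hz.isAffineOn hK
    have hg (x : E2) (hx : x ∈ interior K) : grad z x = b :=
      (hasGradientAt_of_mem_interior hb hx).gradient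
    have inner_sq (x : E2) (hx : x ∈ OmegaCl) : ⟪b, x⟫ ^ 2 ≤ 2 * ‖b‖ ^ 2 := by
      have h1 : ⟪b, x⟫ ^ 2 ≤ (‖b‖ * ‖x‖) ^ 2 :=
        sq_le_sq.2 ((abs_real_inner_le_norm b x).trans (le_abs_self _))
      have h2 := norm_sq_le_two hx
      nlinarith [sq_nonneg ‖b‖]
    have hint : (‖b‖ ^ 2 + c ^ 2) / 5 * volume.real S ≤ H1normSq z := by
      refine (setIntegral_ge_of_const_le_real hSo.measurableSet hfin (fun x hx => ?_)
        ((hz.integrable_H1 hh).mono_measure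
          (Measure.restrict_mono Set.inter_subset_right le_rfl))).trans
        (setIntegral_mono_set (hz.integrable_H1 hh) (Eventually.of_forall fun x => by positivity)
          Set.inter_subset_right.eventuallyLE)
      rw [hg x hx.1, hb x (interior_subset hx.1)]
      have := inner_sq x (Omega_subset hx.2)
      nlinarith [sq_nonneg (2 * (⟪b, x⟫ + c) - ⟪b, x⟫), sq_nonneg (2 * ⟪b, x⟫ + c),
        sq_nonneg (⟪b, x⟫ + c), sq_nonneg (⟪b, x⟫ + c + ⟪b, x⟫)]
    have hbd : 4 * (‖b‖ ^ 2 + c ^ 2) ≤ C * H1normSq z := by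
      calc 4 * (‖b‖ ^ 2 + c ^ 2)
          = 20 / volume.real S * ((‖b‖ ^ 2 + c ^ 2) / 5 * volume.real S) := by
            field_simp; ring
        _ ≤ C * H1normSq z := by gcongr; exact le_trans (by positivity) hC
    constructor
    · intro x hx
      rw [hb x hx]
      have := inner_sq x (hK.subset hh hx)
      nlinarith [sq_nonneg (⟪b, x⟫ - c), sq_nonneg c]
    · intro x hx
      rw [hg x hx]
      nlinarith [sq_nonneg ‖b‖, sq_nonneg c]
  obtain ⟨C, hC⟩ := H.exists
  refine ⟨C, fun z hz => ⟨?_, ?_⟩⟩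
  · refine le_on_OmegaCl (hz.1.pow 2) fun x hx => ?_
    obtain ⟨K, hK, hxK⟩ := exists_isTri_mem hh hx
    exact (hC K hK z hz).1 x hxK
  · filter_upwards [ae_exists_mem_interior hh] with x ⟨K, hK, hx⟩
    exact (hC K hK z hz).2 x hx

lemma tendsto_of_norm_sub_sq_le {E : Type*} [SeminormedAddCommGroup E] {f : ℕ → E} {g : E}
    {e : ℕ → ℝ} (he : Tendsto e atTop (nhds 0)) (hf : ∀ n, ‖f n - g‖ ^ 2 ≤ e n) :
    Tendsto f atTop (nhds g) := by
  rw [tendsto_iff_norm_sub_tendsto_zero]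
  have h1 : Tendsto (fun n => ‖f n - g‖ ^ 2) atTop (nhds 0) :=
    squeeze_zero (fun n => sq_nonneg _) hf he
  simpa [Real.sqrt_sq] using h1.sqrt

lemma norm_le_of_norm_sub_sq_le {E : Type*} [SeminormedAddCommGroup E] {a b : E} {M e : ℝ}
    (hb : ‖b‖ ≤ M) (hab : ‖a - b‖ ^ 2 ≤ e) (he : e ≤ 1) : ‖a‖ ≤ M + 1 := by
  have h1 : ‖a - b‖ ≤ 1 := by nlinarith [norm_nonneg (a - b)]
  have h2 := norm_add_le (a - b) b
  rw [sub_add_cancel] at h2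
  linarith

/-- Convergence in `𝔽_h` is bounded uniform convergence of values and gradients. -/
lemma TendstoF.bounded_convergence {h : ℕ} (hh : 1 ≤ h) {u : ℕ → E2 → ℝ} {ub : E2 → ℝ}
    (hu : ∀ n, MemF h (u n)) (hub : MemF h ub) (hlim : TendstoF u ub) :
    (∀ x ∈ OmegaCl, Tendsto (fun n => u n x) atTop (nhds (ub x))) ∧
    (∃ M, ∀ᶠ n in atTop, ∀ x ∈ OmegaCl, |u n x| ≤ M) ∧
    (∀ᵐ x ∂volume.restrict Omega, Tendsto (fun n => grad (u n) x) atTop (nhds (grad ub x))) ∧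
    ∃ M, ∀ᶠ n in atTop, ∀ᵐ x ∂volume.restrict Omega, ‖grad (u n) x‖ ≤ M := by
  obtain ⟨C, hC⟩ := exists_inverse_inequality hh
  have he : Tendsto (fun n => C * H1normSq (fun y => u n y - ub y)) atTop (nhds 0) := by
    simpa using Tendsto.const_mul C hlim
  have he1 := he.eventually_le_const zero_lt_one
  have hval (n : ℕ) (x : E2) (hx : x ∈ OmegaCl) := (hC _ ((hu n).sub hub)).1 x hx
  have hgrad : ∀ᵐ x ∂volume.restrict Omega, ∀ n,
      ‖grad (u n) x - grad ub x‖ ^ 2 ≤ C * H1normSq (fun y => u n y - ub y) := by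
    rw [ae_all_iff]
    intro n
    filter_upwards [(hC _ ((hu n).sub hub)).2, (hu n).ae_differentiableAt hh,
      hub.ae_differentiableAt hh] with x h1 h2 h3
    rwa [grad_sub h2 h3] at h1
  refine ⟨fun x hx => ?_, ?_, ?_, ?_⟩
  · exact tendsto_of_norm_sub_sq_le he fun n => by simpa using hval n x hx
  · obtain ⟨M, hM⟩ := hub.exists_abs_le
    refine ⟨M + 1, ?_⟩
    filter_upwards [he1] with n hn x hx
    exact norm_le_of_norm_sub_sq_le (a := u n x) (b := ub x) (hM x hx)
      (by simpa using hval n x hx) hn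
  · filter_upwards [hgrad] with x hx using tendsto_of_norm_sub_sq_le he hx
  · obtain ⟨M, hM⟩ := hub.exists_norm_grad_le hh
    refine ⟨M + 1, ?_⟩
    filter_upwards [he1] with n hn
    filter_upwards [hM, hgrad] with x hx hx'
    exact norm_le_of_norm_sub_sq_le hx (hx' n) hn

lemma abs_Ph_le {h : ℕ} (hh : 1 ≤ h) {f : E2 → ℝ} {M : ℝ} (hf : ∀ x ∈ OmegaCl, |f x| ≤ M)
    {x : E2} (hx : x ∈ Omega) : |Ph h f x| ≤ M :=
  abs_le.2 ⟨le_Ph hh (fun y hy => (abs_le.1 (hf y hy)).1) hx,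
    Ph_le hh (fun y hy => (abs_le.1 (hf y hy)).2) hx⟩

/-- The discrete energy is continuous on `𝔽_h × 𝔽_h`. -/
lemma tendsto_Jh {h : ℕ} (hh : 1 ≤ h) (η : ℝ) {u v : ℕ → E2 → ℝ} {ub vb : E2 → ℝ}
    (hu : ∀ n, MemF h (u n)) (hv : ∀ n, MemF h (v n)) (hub : MemF h ub) (hvb : MemF h vb)
    (hcu : TendstoF u ub) (hcv : TendstoF v vb) :
    Tendsto (fun n => Jh h η (u n) (v n)) atTop (nhds (Jh h η ub vb)) := by
  obtain ⟨-, -, hug, Mu, hMu⟩ := hcu.bounded_convergence hh hu hub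
  obtain ⟨hvv, ⟨Mv, hMv⟩, hvg, Mg, hMg⟩ := hcv.bounded_convergence hh hv hvb
  have hO : ∀ᵐ x ∂volume.restrict Omega, x ∈ Omega := ae_restrict_mem isOpen_Omega.measurableSet
  refine Tendsto.add (Tendsto.add ?_ ?_) ?_ <;> refine Tendsto.const_mul _ ?_
  · refine tendsto_integral_filter_of_dominated_convergence (fun _ => (Mv ^ 2 + |η|) * Mu ^ 2)
      (Eventually.of_forall fun n => ((Ph_memF hh _).integrable_weight_mul η
        ((hu n).integrable_norm_grad_sq hh)).aestronglyMeasurable) ?_ (integrable_const _) ?_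
    · filter_upwards [hMu, hMv] with n h1 h2
      filter_upwards [h1, hO] with x h3 h4
      have h5 : |Ph h (fun y => v n y ^ 2) x| ≤ Mv ^ 2 := abs_Ph_le hh (fun y hy => by
        rw [abs_pow]; exact pow_le_pow_left₀ (abs_nonneg _) (h2 y hy) 2) h4
      rw [norm_mul, norm_pow, norm_norm, Real.norm_eq_abs]
      gcongr
      exact (abs_add_le _ _).trans (by gcongr)
    · filter_upwards [hug, hO] with x h1 h2
      exact ((tendsto_Ph hh (fun y hy => (hvv y hy).pow 2) h2).add_const η).mul (h1.norm.pow 2)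
  · refine tendsto_integral_filter_of_dominated_convergence (fun _ => Mg ^ 2)
      (Eventually.of_forall fun n => ((hv n).integrable_norm_grad_sq hh).aestronglyMeasurable) ?_
      (integrable_const _) ?_
    · filter_upwards [hMg] with n h1
      filter_upwards [h1] with x h2
      rw [norm_pow, norm_norm]
      gcongr
    · filter_upwards [hvg] with x h1 using h1.norm.pow 2
  · refine tendsto_integral_filter_of_dominated_convergence (fun _ => (1 + Mv) ^ 2)
      (Eventually.of_forall fun n => (Ph_memF hh _).aestronglyMeasurable) ?_
      (integrable_const _) ?_
    · filter_upwards [hMv] with n h1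
      filter_upwards [hO] with x h2
      refine abs_Ph_le hh (fun y hy => ?_) h2
      rw [abs_pow]
      refine pow_le_pow_left₀ (abs_nonneg _) ((abs_sub _ _).trans ?_) 2
      rw [abs_one]
      linarith [h1 y hy]
    · filter_upwards [hO] with x h1
      exact tendsto_Ph hh (fun y hy => (tendsto_const_nhds.sub (hvv y hy)).pow 2) h1

lemma Jh_add_le {h : ℕ} (hh : 1 ≤ h) (η : ℝ) {u d v : E2 → ℝ} (hu : MemF h u) (hd : MemF h d)
    (hv : MemF h v) (hv01 : ∀ x ∈ Omega, 0 ≤ v x ∧ v x ≤ 1) :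
    Jh h η (fun x => u x + d x) v ≤ Jh h η u v
      + (∫ x in Omega, (Ph h (fun y => (v y) ^ 2) x + η) * ⟪grad u x, grad d x⟫)
      + (1 + η) / 2 * ∫ x in Omega, ‖grad d x‖ ^ 2 := by
  have hO : ∀ᵐ x ∂volume.restrict Omega, x ∈ Omega := ae_restrict_mem isOpen_Omega.measurableSet
  set P := Ph h (fun y => (v y) ^ 2) with hPdef
  have hP : MemF h P := Ph_memF hh _
  have hP1 : ∀ x ∈ Omega, P x ≤ 1 := fun x hx => by
    refine Ph_le hh (le_on_OmegaCl (hv.1.pow 2) fun y hy => ?_) hx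
    exact pow_le_one₀ (hv01 y hy).1 (hv01 y hy).2
  have iu := hP.integrable_weight_mul η (hu.integrable_norm_grad_sq hh)
  have iud := hP.integrable_weight_mul η (hu.integrable_inner_grad hh hd)
  have iuu : Integrable (fun x => (P x + η) * ‖grad u x‖ ^ 2
      + 2 * ((P x + η) * ⟪grad u x, grad d x⟫)) (volume.restrict Omega) := iu.add (iud.const_mul 2)
  have idd := (hd.integrable_norm_grad_sq hh).const_mul (1 + η)
  have key : ∫ x in Omega, (P x + η) * ‖grad (fun y => u y + d y) x‖ ^ 2 ≤
      (∫ x in Omega, (P x + η) * ‖grad u x‖ ^ 2)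
        + 2 * (∫ x in Omega, (P x + η) * ⟪grad u x, grad d x⟫)
        + (1 + η) * ∫ x in Omega, ‖grad d x‖ ^ 2 := by
    rw [← integral_const_mul, ← integral_const_mul, ← integral_add iu (iud.const_mul 2),
      ← integral_add iuu idd]
    refine integral_mono_ae
      (hP.integrable_weight_mul η ((hu.add hd).integrable_norm_grad_sq hh))
      (iuu.add idd) ?_
    filter_upwards [hu.ae_differentiableAt hh, hd.ae_differentiableAt hh, hO] with x h1 h2 h3
    simp only [grad_add h1 h2, norm_add_sq_real]
    nlinarith [mul_le_mul_of_nonneg_right (hP1 x h3) (sq_nonneg ‖grad d x‖)]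
  simp only [Jh, ← hPdef]
  linarith

/-- Energies decrease along the alternating minimization scheme. -/
lemma Jh_alternating_le {h : ℕ} {η : ℝ} {w : E2 → ℝ} {u v : ℕ → E2 → ℝ} (hv0 : MemF h (v 0))
    (hu : ∀ j : ℕ, 1 ≤ j → IsMinU h η w (v (j - 1)) (u j))
    (hv : ∀ j : ℕ, 1 ≤ j → IsMinV h η (u j) (v (j - 1)) (v j)) (n : ℕ) :
    Jh h η (u (n + 1)) (v (n + 1)) ≤ Jh h η (u 1) (v 0) := by
  have hvF (n : ℕ) : MemF h (v n) := by
    cases n with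
    | zero => exact hv0
    | succ n => exact (hv (n + 1) (by lia)).1.1
  have hstep (n : ℕ) : Jh h η (u (n + 1)) (v (n + 1)) ≤ Jh h η (u (n + 1)) (v n) :=
    (hv (n + 1) (by lia)).2 _ (hvF n) fun _ _ => le_rfl
  induction n with
  | zero => exact hstep 0
  | succ n ih =>
    exact (hstep (n + 1)).trans
      (((hu (n + 1 + 1) (by lia)).2 _ (hu (n + 1) (by lia)).1).trans ih)

/-- One-step energy estimate for the alternating scheme with updated
boundary datum: if `(u⁺, v⁺)` is the limit of the alternating minimization sequences with
boundary datum `w'` initialized at `v₋`, where `u₋ ∈ 𝔄_h(w)` and `0 ≤ v₋ ≤ 1` on `Ω`, then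
`J_h(u⁺, v⁺) ≤ J_h(u₋, v₋) + ∫_Ω (P_h(v₋²) + η) ∇u₋·∇(w' − w) dx
  + ((1 + η)/2) ∫_Ω |∇(w' − w)|² dx`. -/
theorem statement13 (h : ℕ) (hh : 1 ≤ h) (η : ℝ) (hη : 0 < η)
    (w w' : E2 → ℝ) (hw : MemF h w) (hw' : MemF h w')
    (um vm : E2 → ℝ) (hum : MemA h w um) (hvm : MemF h vm)
    (hvm01 : ∀ x ∈ Omega, 0 ≤ vm x ∧ vm x ≤ 1)
    (u v : ℕ → E2 → ℝ) (hv0 : v 0 = vm)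
    (hu : ∀ j : ℕ, 1 ≤ j → IsMinU h η w' (v (j-1)) (u j))
    (hv : ∀ j : ℕ, 1 ≤ j → IsMinV h η (u j) (v (j-1)) (v j))
    (up vp : E2 → ℝ) (hup : MemF h up) (hvp : MemF h vp)
    (hcu : TendstoF u up) (hcv : TendstoF v vp) :
    Jh h η up vp ≤ Jh h η um vm
      + (∫ x in Omega, (Ph h (fun y => (vm y)^2) x + η)
          * ⟪grad um x, grad (fun y => w' y - w y) x⟫)
      + (1 + η)/2 * ∫ x in Omega, ‖grad (fun y => w' y - w y) x‖^2 := by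
  have hvF (n : ℕ) : MemF h (v (n + 1)) := (hv (n + 1) (by lia)).1.1
  have hmem : MemA h w' fun x => um x + (w' x - w x) := by
    refine ⟨hum.1.add (hw'.sub hw), fun x hx => ?_⟩
    simp only [hum.2 x hx]
    ring
  have hlim : Jh h η up vp ≤ Jh h η (u 1) (v 0) :=
    le_of_tendsto' (tendsto_Jh hh η (fun n => (hu (n + 1) (by lia)).1.1) hvF hup hvp
      ((tendsto_add_atTop_iff_nat 1).2 hcu) ((tendsto_add_atTop_iff_nat 1).2 hcv))
      (Jh_alternating_le (hv0 ▸ hvm) hu hv)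
  have hmin : Jh h η (u 1) (v 0) ≤ Jh h η (fun x => um x + (w' x - w x)) vm := by
    rw [← hv0]
    exact (hu 1 le_rfl).2 _ hmem
  exact hlim.trans (hmin.trans (Jh_add_le hh η hum.1 (hw'.sub hw) hvm hvm01))
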